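/- arXiv:1002.3113 — 2 statements merged into one kernel-verified Lean document; each statement's English description precedes it below -/
import Mathlib

section
/- Let h, x ∈ ℤ^n and N ∈ ℤ_{≥0}^n. Suppose that for some i ∈ {1,…,n−1} one has N_{i+1} − N_i = x_i − x_{i+1} and h_i = h_{i+1}, or that N_1 − N_n = p − (x_1 − x_n) and h_1 − h_n = p'. Then χ̄^{p',p}_{h,x}[N] = 0. (The hypotheses say N_{i+1} = N_i + (ξ+ρ, α_i) and (η+ρ, α_i) = 0, where for i = n the simple root α_n is the affine root α_0.) -/
open scoped BigOperators Classical

/-- Characters live in formal Laurent series over `ℚ`. -/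
abbrev LS : Type := LaurentSeries ℚ

/-- `q^e` for `e : ℤ`. -/
noncomputable def qpow (e : ℤ) : LS := HahnSeries.single e 1
/-- The number of inversions (the length) of a permutation. -/
def lexp {n : ℕ} (σ : Equiv.Perm (Fin n)) : ℕ :=
  (Finset.univ.filter fun p : Fin n × Fin n => p.1 < p.2 ∧ σ p.2 < σ p.1).card

/-- `S_n` acts on `ℤ^n` by permuting coordinates: `(σ • x)_i = x_{σ⁻¹ i}`. -/
def pact {n : ℕ} (σ : Equiv.Perm (Fin n)) (x : Fin n → ℤ) : Fin n → ℤ := fun i => x (σ⁻¹ i)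

/-- `E(σ,α) = (p'p/2)(α,α) + (p'σ(x) - p h, α) + (x - σ(x), h)`. -/
def Ewt {n : ℕ} (p' p : ℤ) (h x : Fin n → ℤ) (σ : Equiv.Perm (Fin n)) (α : Fin n → ℤ) : ℤ :=
  p' * p * (∑ i, α i * α i) / 2 + (∑ i, (p' * pact σ x i - p * h i) * α i)
    + ∑ i, (x i - pact σ x i) * h i

/-- `v(σ,α) = σ(x) - x + pα`. -/
def vwt {n : ℕ} (p : ℤ) (x : Fin n → ℤ) (σ : Equiv.Perm (Fin n)) (α : Fin n → ℤ) : Fin n → ℤ :=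
  fun i => pact σ x i - x i + p * α i

/-- `(q)_m = Π_{i=1}^m (1 - q^i)` (equal to `1` for `m ≤ 0`). -/
noncomputable def pochZ (m : ℤ) : LS := ∏ i ∈ Finset.range m.toNat, (1 - qpow ((i : ℤ) + 1))

/-- `1/(q)_m`, with the convention that it is `0` for `m < 0`. -/
noncomputable def invPoch (m : ℤ) : LS := if m < 0 then 0 else (pochZ m)⁻¹

/-- The finitized `W_n` character `χ̄^{p',p}_{h,x}[N]`. -/
noncomputable def chibarN (n : ℕ) (p' p : ℤ) (h x : Fin n → ℤ) (N : Fin n → ℤ) : LS :=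
  ∑ σ : Equiv.Perm (Fin n), ∑ᶠ (α : Fin n → ℤ) (_ : ∑ i, α i = 0),
    (-1 : LS) ^ lexp σ * qpow (Ewt p' p h x σ α) * pochZ (∑ i, N i) *
      ∏ i, invPoch (N i - vwt p x σ α i)

section

open Equiv

theorem neg_one_pow_lexp {n : ℕ} (σ : Perm (Fin n)) :
    (-1 : LS) ^ lexp σ = ((Perm.sign σ : ℤ) : LS) := by
  rw [σ.sign_eq_prod_prod_Ioi]
  push_cast
  rw [lexp, ← Finset.prod_const, Finset.prod_filter, Fintype.prod_prod_type]
  refine Finset.prod_congr rfl fun i _ => ?_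
  rw [← Finset.prod_filter_mul_prod_filter_not Finset.univ (fun j => i < j)]
  rw [Finset.prod_eq_one (s := Finset.univ.filter fun j => ¬ i < j), mul_one]
  · refine Finset.prod_congr (by ext; simp) fun j hj => ?_
    have hij : i < j := by simpa using hj
    have hne : σ i ≠ σ j := fun h => hij.ne (σ.injective h)
    by_cases h : σ i < σ j
    · simp [h, h.not_gt]
    · simp [h, hij, lt_of_le_of_ne (not_lt.mp h) hne.symm]
  · intro j hj
    have hij : ¬ i < j := by simpa using hj
    simp [hij]

theorem neg_one_pow_lexp_swap_mul {n : ℕ} {a b : Fin n} (hab : a ≠ b) (σ : Perm (Fin n)) :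
    (-1 : LS) ^ lexp (swap a b * σ) = -(-1 : LS) ^ lexp σ := by
  simp [neg_one_pow_lexp, Perm.sign_swap hab]

theorem pact_swap_mul {n : ℕ} (a b : Fin n) (σ : Perm (Fin n)) (x : Fin n → ℤ) (i : Fin n) :
    pact (swap a b * σ) x i = pact σ x (swap a b i) := by
  simp [pact]

/-- The root `e_a - e_b`. -/
def root {n : ℕ} (a b : Fin n) : Fin n → ℤ := Pi.single a 1 - Pi.single b 1

theorem sum_mul_root {n : ℕ} (a b : Fin n) (f : Fin n → ℤ) :
    ∑ i, f i * root a b i = f a - f b := by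
  simp [root, mul_sub, Finset.sum_sub_distrib, Pi.single_apply]

theorem root_swap {n : ℕ} (a b i : Fin n) : root a b (swap a b i) = -root a b i := by
  rcases eq_or_ne i a with rfl | ha
  · simp [root, Pi.single_apply, eq_comm]
  rcases eq_or_ne i b with rfl | hb
  · simp [root, Pi.single_apply, eq_comm]
  rw [swap_apply_of_ne_of_ne ha hb]
  simp [root, ha, hb]

/-- A function is moved by a transposition along the corresponding root. -/
theorem apply_swap_eq {n : ℕ} {a b : Fin n} {f : Fin n → ℤ} {k : ℤ} (hab : a ≠ b)
    (hf : f a - f b = k) (i : Fin n) : f (swap a b i) = f i - k * root a b i := by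
  rcases eq_or_ne i a with rfl | ha
  · simp [root, hab]; omega
  rcases eq_or_ne i b with rfl | hb
  · simp [root, hab.symm]; omega
  rw [swap_apply_of_ne_of_ne ha hb]
  simp [root, ha, hb]

/-- The affine reflection `α ↦ s_{ab}(α) + c (e_a - e_b)`. -/
def affRefl {n : ℕ} (a b : Fin n) (c : ℤ) (α : Fin n → ℤ) : Fin n → ℤ :=
  fun i => α (swap a b i) + c * root a b i

theorem affRefl_involutive {n : ℕ} (a b : Fin n) (c : ℤ) :
    Function.Involutive (affRefl a b c) := by
  intro α
  funext i
  simp [affRefl, root_swap]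

theorem sum_affRefl {n : ℕ} (a b : Fin n) (c : ℤ) (α : Fin n → ℤ) :
    ∑ i, affRefl a b c α i = ∑ i, α i := by
  have h := sum_mul_root a b fun _ => c
  simp only [sub_self] at h
  simp only [affRefl, Finset.sum_add_distrib, h, add_zero]
  exact Equiv.sum_comp (swap a b) α

theorem sub_vwt_affRefl {n : ℕ} {a b : Fin n} (hab : a ≠ b) {c p : ℤ} {x N : Fin n → ℤ}
    (hN : N a - N b = c * p - (x a - x b)) (σ : Perm (Fin n)) (α : Fin n → ℤ) (i : Fin n) :
    N i - vwt p x (swap a b * σ) (affRefl a b c α) i =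
      N (swap a b i) - vwt p x σ α (swap a b i) := by
  have h := apply_swap_eq (f := fun i => N i + x i) (k := c * p) hab (by linarith) i
  simp only [vwt, pact_swap_mul, affRefl] at h ⊢
  linear_combination -h

theorem Ewt_affRefl {n : ℕ} {a b : Fin n} (hab : a ≠ b) {c p' : ℤ} (p : ℤ) {h : Fin n → ℤ}
    (x : Fin n → ℤ) (hh : h a - h b = c * p') (σ : Perm (Fin n)) (α : Fin n → ℤ) :
    Ewt p' p h x (swap a b * σ) (affRefl a b c α) = Ewt p' p h x σ α := by
  have hs := apply_swap_eq hab hh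
  set y := pact σ x with hy
  have hrr : ∑ i, root a b i * root a b i = 2 := by
    rw [sum_mul_root]; simp [root, hab, hab.symm]
  have e1 : ∑ i, affRefl a b c α i * affRefl a b c α i =
      ∑ i, α i * α i + 2 * (c * c - c * (α a - α b)) := by
    rw [← Equiv.sum_comp (swap a b)]
    simp only [affRefl, swap_apply_self, root_swap]
    rw [← sum_mul_root a b α]
    calc _ = ∑ i, (α i * α i + (-2 * c) * (α i * root a b i)
            + c * c * (root a b i * root a b i)) := Finset.sum_congr rfl fun i _ => by ring
      _ = _ := by
        simp only [Finset.sum_add_distrib, ← Finset.mul_sum, hrr]; ring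
  have e2 : ∑ i, (p' * pact (swap a b * σ) x i - p * h i) * affRefl a b c α i =
      ∑ i, (p' * y i - p * h i) * α i - c * (p' * (y a - y b) - p * (h a - h b))
        + p * c * p' * (α a - α b) - 2 * p * c * c * p' := by
    rw [← Equiv.sum_comp (swap a b)]
    simp only [affRefl, swap_apply_self, root_swap, pact_swap_mul, hs]
    rw [← sum_mul_root a b α, ← sum_mul_root a b y, ← sum_mul_root a b h]
    calc _ = ∑ i, ((p' * y i - p * h i) * α i + (-c * p') * (y i * root a b i)
            + (c * p) * (h i * root a b i) + (p * c * p') * (α i * root a b i)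
            + (-(p * c * c * p')) * (root a b i * root a b i)) :=
          Finset.sum_congr rfl fun i _ => by ring
      _ = _ := by
        simp only [Finset.sum_add_distrib, ← Finset.mul_sum, hrr]; ring
  have e3 : ∑ i, (x i - pact (swap a b * σ) x i) * h i =
      ∑ i, (x i - y i) * h i + c * p' * (y a - y b) := by
    have : ∑ i, y (swap a b i) * h i = ∑ i, y i * h (swap a b i) := by
      rw [← Equiv.sum_comp (swap a b)]; simp only [swap_apply_self]
    simp only [pact_swap_mul, sub_mul, Finset.sum_sub_distrib, ← hy, this, hs]
    rw [← sum_mul_root a b y, Finset.mul_sum]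
    simp only [mul_sub, Finset.sum_sub_distrib]
    have : ∀ i, y i * (c * p' * root a b i) = c * p' * (y i * root a b i) := fun i => by ring
    simp only [this]; ring
  have e4 : p' * p * (∑ i, α i * α i + 2 * (c * c - c * (α a - α b))) =
      p' * p * (∑ i, α i * α i) + p' * p * (c * c - c * (α a - α b)) * 2 := by ring
  rw [Ewt, Ewt, e1, e2, e3, e4, Int.add_mul_ediv_right _ _ two_ne_zero, hh]
  ring

theorem chibarN_eq_zero {n : ℕ} {a b : Fin n} (hab : a ≠ b) {c p' p : ℤ} {h x N : Fin n → ℤ}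
    (hN : N a - N b = c * p - (x a - x b)) (hh : h a - h b = c * p') :
    chibarN n p' p h x N = 0 := by
  have key : chibarN n p' p h x N = -chibarN n p' p h x N := by
    conv_lhs => rw [chibarN, ← Equiv.sum_comp (Equiv.mulLeft (swap a b))]
    rw [chibarN, ← Finset.sum_neg_distrib]
    refine Finset.sum_congr rfl fun σ _ => ?_
    rw [← finsum_comp_equiv (affRefl_involutive a b c).toPerm, ← finsum_neg_distrib]
    refine finsum_congr fun α => ?_
    rw [← finsum_neg_distrib]
    simp only [Function.Involutive.coe_toPerm, sum_affRefl, Equiv.coe_mulLeft,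
      neg_one_pow_lexp_swap_mul hab, Ewt_affRefl hab p x hh, sub_vwt_affRefl hab hN]
    refine finsum_congr fun _ => ?_
    rw [Equiv.prod_comp (swap a b) fun i => invPoch (N i - vwt p x σ α i)]
    ring
  have h2 : (2 : LS) * chibarN n p' p h x N = 0 := by linear_combination key
  have two_ne : (2 : LS) ≠ 0 := by
    have : (2 : LS) = HahnSeries.C (2 : ℚ) := by simp
    rw [this]
    exact HahnSeries.C_ne_zero two_ne_zero
  exact (mul_eq_zero.mp h2).resolve_left two_ne

end

/-- Proposition 4.4 (ii): if `N_{i+1} = N_i + (ξ+ρ,α_i)` and `(η+ρ,α_i) = 0` for some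
simple root `α_i` (including the affine one for `i = n`), then `χ̄^{p',p}_{h,x}[N] = 0`. -/
theorem chibar_vanishing (n : ℕ) [NeZero n] (hn : 2 ≤ n) (p' p : ℤ)
    (h x : Fin n → ℤ) (N : Fin n → ℤ) (hN : ∀ i, 0 ≤ N i)
    (hyp : (∃ i : Fin n, (i : ℕ) + 1 < n ∧
        N (i + 1) - N i = x i - x (i + 1) ∧ h i = h (i + 1)) ∨
      (N ⟨0, by omega⟩ - N ⟨n - 1, by omega⟩
          = p - (x ⟨0, by omega⟩ - x ⟨n - 1, by omega⟩)
        ∧ h ⟨0, by omega⟩ - h ⟨n - 1, by omega⟩ = p')) :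
    chibarN n p' p h x N = 0 := by
  rcases hyp with ⟨i, hi, hNi, hhi⟩ | ⟨hNn, hhn⟩
  · have hne : i ≠ i + 1 := by
      intro he
      have := Fin.val_add_one_of_lt' hi
      rw [← he] at this
      omega
    exact chibarN_eq_zero (c := 0) hne (by linarith) (by linarith)
  · refine chibarN_eq_zero (a := ⟨0, by omega⟩) (b := ⟨n - 1, by omega⟩) (c := 1) ?_
      (by rw [one_mul]; exact hNn) (by rw [one_mul]; exact hhn)
    simp only [ne_eq, Fin.mk.injEq]
    omega
end

section
/- If x ∈ ℤ^n satisfies x_i − x_{i+1} ≥ 1 for i = 1,…,n−1 and x_1 − x_n ≤ p − 1 (i.e. the corresponding weight ξ is a dominant integral weight of level p − n), then for every h ∈ ℤ^n one has χ̄^{p',p}_{h,x}[0] = 1, where 0 = (0,…,0) ∈ ℤ^n. -/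
open scoped BigOperators Classical

theorem strictAnti_of_consecutive_gap {n : ℕ} [NeZero n] {x : Fin n → ℤ}
    (hx : ∀ i : Fin n, (i : ℕ) + 1 < n → 1 ≤ x i - x (i + 1)) : StrictAnti x := by
  have key : ∀ b (hb : b < n) (a : Fin n), (a : ℕ) < b → x ⟨b, hb⟩ < x a := by
    intro b
    induction b with
    | zero => intro _ a ha; omega
    | succ b ih =>
      intro hb a ha
      have hstep := hx ⟨b, by omega⟩ hb
      have hsucc : (⟨b, by omega⟩ : Fin n) + 1 = ⟨b + 1, hb⟩ :=
        Fin.ext (Fin.val_add_one_of_lt' hb)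
      rw [hsucc] at hstep
      rcases Nat.lt_succ_iff_lt_or_eq.mp ha with hlt | heq
      · have := ih (by omega) a hlt
        omega
      · have hab : a = ⟨b, by omega⟩ := Fin.ext heq
        rw [hab]
        omega
  exact fun a b hab => key b b.isLt a hab

theorem sum_vwt {n : ℕ} (p : ℤ) (x : Fin n → ℤ) (σ : Equiv.Perm (Fin n)) {α : Fin n → ℤ}
    (hα : ∑ i, α i = 0) : ∑ i, vwt p x σ α i = 0 := by
  have hperm : ∑ i, x (σ⁻¹ i) = ∑ i, x i := Equiv.sum_comp σ⁻¹ x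
  simp [vwt, pact, Finset.sum_add_distrib, ← Finset.mul_sum, hα]
  exact sub_eq_zero.mpr hperm

theorem prod_invPoch_neg_eq_zero {n : ℕ} {v : Fin n → ℤ} (hsum : ∑ i, v i = 0) (hv : v ≠ 0) :
    ∏ i, invPoch (0 - v i) = 0 := by
  obtain ⟨i, hi⟩ : ∃ i, 0 < v i := by
    by_contra! hle
    refine hv (funext fun i => ?_)
    exact (Finset.sum_eq_zero_iff_of_nonpos fun j _ => hle j).mp hsum i (Finset.mem_univ i)
  exact Finset.prod_eq_zero (Finset.mem_univ i) (if_pos (by omega))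

/-- The affine Weyl group acts freely on the interior of the fundamental alcove. -/
theorem eq_one_and_eq_zero_of_vwt_eq_zero {n : ℕ} {p : ℤ} {x : Fin n → ℤ}
    (hinj : Function.Injective x) (hwidth : ∀ i j, x i - x j ≤ p - 1)
    {σ : Equiv.Perm (Fin n)} {α : Fin n → ℤ} (hv : vwt p x σ α = 0) : σ = 1 ∧ α = 0 := by
  have hvi (i : Fin n) : x (σ⁻¹ i) - x i + p * α i = 0 := congrFun hv i
  have hα : α = 0 := by
    funext i
    have hdvd : p ∣ x i - x (σ⁻¹ i) := ⟨α i, by linarith [hvi i]⟩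
    have hp : 0 < p := by linarith [hwidth i i]
    have habs : |x i - x (σ⁻¹ i)| < p :=
      abs_lt.mpr ⟨by linarith [hwidth (σ⁻¹ i) i], by linarith [hwidth i (σ⁻¹ i)]⟩
    have hdiff := Int.eq_zero_of_abs_lt_dvd hdvd habs
    have hmul : p * α i = 0 := by linarith [hvi i]
    exact (mul_eq_zero.mp hmul).resolve_left hp.ne'
  refine ⟨?_, hα⟩
  have hσ : σ⁻¹ = 1 := by
    ext1 i
    apply hinj
    have := hvi i
    rw [hα] at this
    simpa [sub_eq_zero] using this
  exact inv_eq_one.mp hσ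

theorem lexp_one {n : ℕ} : lexp (1 : Equiv.Perm (Fin n)) = 0 := by
  simp only [lexp, Finset.card_eq_zero, Finset.filter_eq_empty_iff]
  rintro ⟨a, b⟩ - ⟨hab, hba⟩
  exact lt_asymm hab hba

theorem Ewt_one_zero {n : ℕ} (p' p : ℤ) (h x : Fin n → ℤ) : Ewt p' p h x 1 0 = 0 := by
  simp [Ewt, pact]

theorem vwt_one_zero {n : ℕ} (p : ℤ) (x : Fin n → ℤ) : vwt p x 1 0 = 0 := by
  funext i
  simp [vwt, pact]

theorem qpow_zero : qpow 0 = 1 := rfl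

theorem pochZ_zero : pochZ 0 = 1 := by simp [pochZ]

theorem invPoch_zero : invPoch 0 = 1 := by simp [invPoch, pochZ_zero]

/-- Proposition 4.4 (iii): if `ξ` is dominant of level `p - n`
(`x_i - x_{i+1} ≥ 1` for `i < n` and `x_1 - x_n ≤ p - 1`), then `χ̄^{p',p}_{h,x}[0] = 1`. -/
theorem chibar_initial (n : ℕ) [NeZero n] (hn : 2 ≤ n) (p' p : ℤ)
    (x : Fin n → ℤ)
    (hx1 : ∀ i : Fin n, (i : ℕ) + 1 < n → 1 ≤ x i - x (i + 1))
    (hx2 : x ⟨0, by omega⟩ - x ⟨n - 1, by omega⟩ ≤ p - 1)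
    (h : Fin n → ℤ) :
    chibarN n p' p h x (fun _ => 0) = 1 := by
  have hanti := strictAnti_of_consecutive_gap hx1
  have hwidth (i j : Fin n) : x i - x j ≤ p - 1 := by
    have hi : x i ≤ x ⟨0, by omega⟩ := hanti.antitone (Fin.mk_le_of_le_val (Nat.zero_le _))
    have hj : x ⟨n - 1, by omega⟩ ≤ x j :=
      hanti.antitone (Fin.le_def.mpr (Nat.le_sub_one_of_lt j.isLt))
    linarith
  have hvanish {σ : Equiv.Perm (Fin n)} {α : Fin n → ℤ} (hα : ∑ i, α i = 0)
      (hne : ¬(σ = 1 ∧ α = 0)) : ∏ i, invPoch (0 - vwt p x σ α i) = 0 :=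
    prod_invPoch_neg_eq_zero (sum_vwt p x σ hα) fun hv =>
      hne (eq_one_and_eq_zero_of_vwt_eq_zero hanti.injective hwidth hv)
  unfold chibarN
  rw [Finset.sum_eq_single 1, finsum_eq_single _ (0 : Fin n → ℤ)]
  · simp [lexp_one, Ewt_one_zero, vwt_one_zero, qpow_zero, pochZ_zero, invPoch_zero]
  · intro α hα
    refine (finsum_congr fun hsum => ?_).trans finsum_zero
    rw [hvanish hsum fun hc => hα hc.2, mul_zero]
  · intro σ _ hσ
    refine finsum_eq_zero_of_forall_eq_zero fun α =>
      (finsum_congr fun hsum => ?_).trans finsum_zero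
    rw [hvanish hsum fun hc => hσ hc.1, mul_zero]
  · simp
end
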